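/- arXiv:1510.00282 — 2 statements merged into one kernel-verified Lean document; each statement's English description precedes it below -/
import Mathlib

section
/- Any infinite word x over a finite alphabet which is not ultimately periodic satisfies liminf_{n→∞} p(n, x)/n ≥ rep(x) − 1 + 1/rep(x)³, where rep(x) = liminf r(n, x)/n, provided rep(x) is finite. -/
open Filter

/-- `x` is ultimately periodic. -/
def UltimatelyPeriodic {A : Type*} (x : ℕ → A) : Prop :=
  ∃ N T : ℕ, 0 < T ∧ ∀ k ≥ N, x (k + T) = x k

/-- The set of lengths `m` of prefixes of `x` whose last `n` letters occur
a second time inside the prefix. -/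
def returnSet {A : Type*} (x : ℕ → A) (n : ℕ) : Set ℕ :=
  {m : ℕ | ∃ i : ℕ, i + n < m ∧ ∀ k < n, x (i + k) = x (m - n + k)}

/-- `r(n, x)`: the length of the smallest prefix of `x` containing two
(possibly overlapping) occurrences of some word of length `n`. -/
noncomputable def minReturn {A : Type*} (x : ℕ → A) (n : ℕ) : ℕ :=
  sInf (returnSet x n)


/-- Number of distinct factors of length `n` of the infinite word `x`. -/
noncomputable def complexity {A : Type*} (x : ℕ → A) (n : ℕ) : ℕ :=
  Set.ncard {w : Fin n → A | ∃ j : ℕ, ∀ k : Fin n, w k = x (j + k)}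

/-- The word of length `n` at position `j` also occurs at an earlier position. -/
def OccursBefore {A : Type*} (x : ℕ → A) (n j : ℕ) : Prop :=
  ∃ i < j, ∀ k < n, x (i + k) = x (j + k)

/-- The first position at which a word of length `n` occurs for the second time. -/
noncomputable def firstReturn {A : Type*} (x : ℕ → A) (n : ℕ) : ℕ :=
  sInf {j | OccursBefore x n j}

/-- The factor of length `n` of `x` at position `j`. -/
def factorAt {A : Type*} (x : ℕ → A) (n j : ℕ) : Fin n → A := fun k => x (j + k)

section Combinatorics

variable {A : Type*} (x : ℕ → A)

lemma complexity_eq_ncard_range (n : ℕ) :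
    complexity x n = (Set.range (factorAt x n)).ncard := by
  unfold complexity
  congr 1
  ext w
  simp only [Set.mem_ofPred_eq, Set.mem_range, funext_iff, factorAt]
  exact exists_congr fun j => forall_congr' fun k => eq_comm

lemma factorAt_eq_iff {n i j : ℕ} :
    factorAt x n i = factorAt x n j ↔ ∀ k < n, x (i + k) = x (j + k) := by
  simp only [funext_iff, factorAt]
  exact ⟨fun h k hk => h ⟨k, hk⟩, fun h k => h k k.2⟩

lemma firstReturn_le {n j : ℕ} (h : OccursBefore x n j) : firstReturn x n ≤ j :=
  Nat.sInf_le h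

lemma firstReturn_zero_le : firstReturn x 0 ≤ 1 :=
  firstReturn_le x ⟨0, one_pos, fun k hk => absurd hk (Nat.not_lt_zero k)⟩

variable [Fintype A]

lemma exists_occursBefore (n : ℕ) : ∃ j, OccursBefore x n j := by
  obtain ⟨i, j, hij, h⟩ := Finite.exists_ne_map_eq_of_infinite (factorAt x n)
  rw [factorAt_eq_iff] at h
  rcases lt_or_gt_of_ne hij with hlt | hlt
  · exact ⟨j, i, hlt, h⟩
  · exact ⟨i, j, hlt, fun k hk => (h k hk).symm⟩

lemma occursBefore_firstReturn (n : ℕ) : OccursBefore x n (firstReturn x n) :=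
  Nat.sInf_mem (exists_occursBefore x n)

lemma firstReturn_mono : Monotone (firstReturn x) := fun m n hmn => by
  obtain ⟨i, hi, h⟩ := occursBefore_firstReturn x n
  exact firstReturn_le x ⟨i, hi, fun k hk => h k (hk.trans_le hmn)⟩

lemma minReturn_le_firstReturn_add (n : ℕ) : minReturn x n ≤ firstReturn x n + n := by
  obtain ⟨i, hi, h⟩ := occursBefore_firstReturn x n
  refine Nat.sInf_le ⟨i, by omega, fun k hk => ?_⟩
  rw [Nat.add_sub_cancel]
  exact h k hk

lemma le_minReturn (n : ℕ) : n ≤ minReturn x n := by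
  obtain ⟨i, hi, h⟩ := occursBefore_firstReturn x n
  have hne : (returnSet x n).Nonempty := by
    refine ⟨firstReturn x n + n, i, by omega, fun k hk => ?_⟩
    rw [Nat.add_sub_cancel]
    exact h k hk
  obtain ⟨i', hi', -⟩ := Nat.sInf_mem hne
  change i' + n < minReturn x n at hi'
  omega

lemma firstReturn_le_complexity (n : ℕ) : firstReturn x n ≤ complexity x n := by
  have hinj : Set.InjOn (factorAt x n) (Set.Iio (firstReturn x n)) := by
    intro i hi j hj hij
    simp only [Set.mem_Iio] at hi hj
    rw [factorAt_eq_iff] at hij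
    by_contra hne
    rcases lt_or_gt_of_ne hne with hlt | hlt
    · exact absurd (firstReturn_le x ⟨i, hlt, hij⟩) (by omega)
    · exact absurd (firstReturn_le x ⟨j, hlt, fun k hk => (hij k hk).symm⟩) (by omega)
  rw [complexity_eq_ncard_range, ← Nat.card_Iio (firstReturn x n), ← Set.ncard_coe_finset,
    Finset.coe_Iio, ← hinj.ncard_image]
  exact Set.ncard_le_ncard (Set.image_subset_range _ _) (Set.toFinite _)

lemma complexity_lt_succ (hx : ¬ UltimatelyPeriodic x) (n : ℕ) :
    complexity x n < complexity x (n + 1) := by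
  by_contra! hle
  apply hx
  rw [complexity_eq_ncard_range, complexity_eq_ncard_range] at hle
  have himage : (fun w : Fin (n + 1) → A => fun k : Fin n => w k.castSucc) ''
      Set.range (factorAt x (n + 1)) = Set.range (factorAt x n) := by
    rw [← Set.range_comp]
    rfl
  have hinj : Set.InjOn (fun w : Fin (n + 1) → A => fun k : Fin n => w k.castSucc)
      (Set.range (factorAt x (n + 1))) := by
    apply Set.injOn_of_ncard_image_eq _ (Set.toFinite _)
    exact le_antisymm (Set.ncard_image_le (Set.toFinite _)) (himage ▸ hle)
  have hext : ∀ i j, factorAt x n i = factorAt x n j →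
      factorAt x (n + 1) i = factorAt x (n + 1) j :=
    fun i j h => hinj ⟨i, rfl⟩ ⟨j, rfl⟩ h
  obtain ⟨i, hi, h⟩ := occursBefore_firstReturn x n
  set j := firstReturn x n
  have hshift : ∀ t, factorAt x n (i + t) = factorAt x n (j + t) := by
    intro t
    induction t with
    | zero => exact (factorAt_eq_iff x).2 h
    | succ t ih =>
      have h1 := (factorAt_eq_iff x).1 (hext _ _ ih)
      refine (factorAt_eq_iff x).2 fun k hk => ?_
      convert h1 (k + 1) (by omega) using 2 <;> ring
  refine ⟨i + n, j - i, by omega, fun k hk => ?_⟩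
  have h2 := (factorAt_eq_iff x).1 (hext _ _ (hshift (k - (i + n)))) n (by omega)
  rw [show k + (j - i) = j + (k - (i + n)) + n by omega, ← h2]
  congr 1
  omega

lemma complexity_add_le (hx : ¬ UltimatelyPeriodic x) (n t : ℕ) :
    complexity x n + t ≤ complexity x (n + t) := by
  induction t with
  | zero => simp
  | succ t ih =>
    have := complexity_lt_succ x hx (n + t)
    rw [show n + (t + 1) = n + t + 1 from rfl]
    omega

/-- Two overlapping repetitions starting at the positions `R₁ < R₀` force an early repetition
of two shorter words. -/
lemma exists_shift_of_overlapping_returns {l₀ l₁ m : ℕ} (hl : l₁ < l₀)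
    (hR : firstReturn x l₁ < firstReturn x l₀)
    (hjump : firstReturn x l₁ < firstReturn x (l₁ + 1))
    (hm : firstReturn x l₀ + m = firstReturn x l₁ + l₁) :
    ∃ τ, firstReturn x m + τ ≤ firstReturn x l₀ ∧
      (τ ≤ m → firstReturn x (m - τ) + m < firstReturn x l₀ + τ) := by
  obtain ⟨i₀, hi₀, h₀⟩ := occursBefore_firstReturn x l₀
  obtain ⟨i₁, hi₁, h₁⟩ := occursBefore_firstReturn x l₁
  have hne : x (i₁ + l₁) ≠ x (firstReturn x l₁ + l₁) := by
    intro h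
    refine absurd (firstReturn_le x (n := l₁ + 1) ⟨i₁, hi₁, fun k hk => ?_⟩) (not_le.2 hjump)
    rcases Nat.lt_succ_iff_lt_or_eq.1 hk with hk | rfl
    · exact h₁ k hk
    · exact h
  have hret : ∀ {n j : ℕ}, OccursBefore x n j → firstReturn x n ≤ j := firstReturn_le x
  generalize firstReturn x l₀ = R₀ at *
  generalize firstReturn x l₁ = R₁ at *
  obtain ⟨T₀, hT₀⟩ : ∃ T₀, R₀ = i₀ + T₀ := ⟨R₀ - i₀, by omega⟩
  obtain ⟨T₁, hT₁⟩ : ∃ T₁, R₁ = i₁ + T₁ := ⟨R₁ - i₁, by omega⟩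
  have p₀ : ∀ q, i₀ ≤ q → q < i₀ + l₀ → x q = x (q + T₀) := fun q h1 h2 => by
    have := h₀ (q - i₀) (by omega)
    rwa [show i₀ + (q - i₀) = q by omega, show R₀ + (q - i₀) = q + T₀ by omega] at this
  have p₁ : ∀ q, i₁ ≤ q → q < i₁ + l₁ → x q = x (q + T₁) := fun q h1 h2 => by
    have := h₁ (q - i₁) (by omega)
    rwa [show i₁ + (q - i₁) = q by omega, show R₁ + (q - i₁) = q + T₁ by omega] at this
  have hTne : T₀ ≠ T₁ := by
    rintro rfl
    apply hne
    rw [p₀ (i₁ + l₁) (by omega) (by omega)]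
    congr 1
    omega
  have hlong : T₁ ≤ m → ¬ T₀ ≤ l₁ := by
    intro h1 h2
    apply hne
    have e1 := p₁ (i₁ + l₁ - T₀) (by omega) (by omega)
    have e2 := p₀ (i₁ + l₁ - T₀) (by omega) (by omega)
    have e3 := p₀ (R₁ + l₁ - T₀) (by omega) (by omega)
    rw [show i₁ + l₁ - T₀ + T₁ = R₁ + l₁ - T₀ by omega] at e1
    rw [show i₁ + l₁ - T₀ + T₀ = i₁ + l₁ by omega] at e2
    rw [show R₁ + l₁ - T₀ + T₀ = R₁ + l₁ by omega] at e3
    rw [← e2, e1, e3]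
  have w₀ : ∀ k < m, x (i₀ + k) = x (R₀ + k) := fun k hk => h₀ k (by omega)
  have w₁ : ∀ k < m, x (i₁ + (R₀ - R₁) + k) = x (R₀ + k) := fun k hk => by
    rw [add_assoc, h₁ (R₀ - R₁ + k) (by omega)]
    congr 1
    omega
  rcases lt_or_gt_of_ne hTne with hlt | hlt
  · refine ⟨T₀, ?_, fun hτ => ?_⟩
    · have := hret (n := m) (j := i₀)
        ⟨i₁ + (R₀ - R₁), by omega, fun k hk => (w₁ k hk).trans (w₀ k hk).symm⟩
      omega
    · have := hret (n := m - T₀) (j := i₁ + (R₀ - R₁) + T₀)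
        ⟨i₁ + (R₀ - R₁), by omega, fun k hk => by
          rw [add_assoc _ T₀ k, w₁ k (by omega), w₁ (T₀ + k) (by omega), ← w₀ k (by omega),
            ← w₀ (T₀ + k) (by omega), p₀ _ (by omega) (by omega)]
          congr 1
          omega⟩
      omega
  · refine ⟨T₁, ?_, fun hτ => ?_⟩
    · have := hret (n := m) (j := i₁ + (R₀ - R₁))
        ⟨i₀, by omega, fun k hk => (w₀ k hk).trans (w₁ k hk).symm⟩
      omega
    · have := hret (n := m - T₁) (j := i₀ + T₁)
        ⟨i₀, by omega, fun k hk => by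
          rw [add_assoc _ T₁ k, w₀ k (by omega), w₀ (T₁ + k) (by omega), ← w₁ k (by omega),
            ← w₁ (T₁ + k) (by omega), p₁ _ (by omega) (by omega)]
          congr 1
          omega⟩
      omega

end Combinatorics

/-- A linear lower bound for the first returns improves to a strictly larger one for the
complexity. -/
lemma eventually_mul_le_complexity {A : Type*} [Fintype A] (x : ℕ → A)
    (hx : ¬ UltimatelyPeriodic x) {r B η : ℝ} (hr : 1 < r) (hr3 : 0 ≤ r ^ 3 - r ^ 2 - r - 1)
    (hη : 0 < η) (hB : ∀ k : ℕ, (r - 1) * k - B ≤ firstReturn x k) :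
    ∀ᶠ n : ℕ in atTop, (r - 1 + 1 / r ^ 3 - η) * n ≤ complexity x n := by
  have hr0 : 0 < r := by linarith
  have hgrow1 : ∀ᶠ n : ℕ in atTop, r ^ 3 * (B + 1) ≤ r ^ 3 * η * n :=
    (tendsto_natCast_atTop_atTop.const_mul_atTop (by positivity)).eventually_ge_atTop _
  have hgrow2 : ∀ᶠ n : ℕ in atTop, B + 2 ≤ (r - 1) * n :=
    (tendsto_natCast_atTop_atTop.const_mul_atTop (by linarith)).eventually_ge_atTop (B + 2)
  filter_upwards [hgrow1, hgrow2] with n hn1 hn2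
  by_contra! hlt
  have hmono := firstReturn_mono x
  have hRn := hB n
  have hzero : firstReturn x 0 < firstReturn x n := by
    have h1 : (1 : ℝ) < firstReturn x n := by linarith
    have h2 : 1 < firstReturn x n := by exact_mod_cast h1
    exact (firstReturn_zero_le x).trans_lt h2
  have hex : ∃ l, firstReturn x n ≤ firstReturn x l := ⟨n, le_rfl⟩
  obtain ⟨l₁, hl₁⟩ : ∃ l₁, Nat.find hex = l₁ + 1 := by
    refine Nat.exists_eq_succ_of_ne_zero fun h => ?_
    have := Nat.find_spec hex
    rw [h] at this
    omega
  have hl₁n : l₁ + 1 ≤ n := hl₁ ▸ Nat.find_min' hex le_rfl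
  have hlow : firstReturn x l₁ < firstReturn x n :=
    not_le.1 (Nat.find_min hex (by omega))
  have hhigh : firstReturn x (l₁ + 1) = firstReturn x n :=
    le_antisymm (hmono hl₁n) (hl₁ ▸ Nat.find_spec hex)
  have hcomp : (firstReturn x n : ℝ) + (n - l₁ - 1) ≤ complexity x n := by
    have h1 := complexity_add_le x hx (l₁ + 1) (n - (l₁ + 1))
    have h2 := firstReturn_le_complexity x (l₁ + 1)
    rw [Nat.add_sub_cancel' hl₁n] at h1
    have h3 : firstReturn x n + n ≤ complexity x n + l₁ + 1 := by omega
    have h4 : ((firstReturn x n + n : ℕ) : ℝ) ≤ (complexity x n + l₁ + 1 : ℕ) := by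
      exact_mod_cast h3
    push_cast at h4
    linarith
  have hR1 := hB l₁
  set δ : ℝ := 1 / r ^ 3 - η with hδ
  have hδr : r ^ 3 * δ = 1 - r ^ 3 * η := by
    rw [hδ]
    field_simp
  have hub : (firstReturn x n : ℝ) ≤ (r - 1 + δ) * n + 1 - (n - l₁) := by
    have : (r - 1 + δ) * n = (r - 1 + 1 / r ^ 3 - η) * n := by rw [hδ]; ring
    linarith
  have hgap : (n : ℝ) - l₁ ≤ δ * n + 1 + B := by linarith
  have hkey : (1 + r + r ^ 2) * (firstReturn x n + B) ≤ r ^ 3 * l₁ := by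
    have h1 := mul_le_mul_of_nonneg_left hub (by positivity : 0 ≤ 1 + r + r ^ 2)
    have h2 := mul_le_mul_of_nonneg_left hgap hr3
    have h3 : r ^ 3 * δ * n = (1 - r ^ 3 * η) * n := by rw [hδr]
    linarith
  set M : ℝ := l₁ + firstReturn x l₁ - firstReturn x n with hM
  have hMlow : r * l₁ - firstReturn x n - B ≤ M := by linarith
  have hMkey : (1 + r) * (firstReturn x n + B) ≤ r ^ 2 * M := by
    have := mul_le_mul_of_nonneg_left hMlow (by positivity : 0 ≤ r ^ 2)
    linarith
  have hpos : 0 < (firstReturn x n : ℝ) + B := by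
    have : (0 : ℝ) < n := by exact_mod_cast (by omega : 0 < n)
    have := mul_pos (sub_pos.2 hr) this
    linarith
  have hMpos : 0 < M := pos_of_mul_pos_right
    ((mul_pos (by linarith) hpos).trans_le hMkey) (by positivity)
  obtain ⟨m, hm⟩ : ∃ m, firstReturn x n + m = firstReturn x l₁ + l₁ := by
    have : (firstReturn x n : ℝ) ≤ (firstReturn x l₁ + l₁ : ℕ) := by
      push_cast
      linarith
    exact (Nat.exists_eq_add_of_le (by exact_mod_cast this)).imp fun _ h => h.symm
  have hmM : (m : ℝ) = M := by
    have : ((firstReturn x n + m : ℕ) : ℝ) = (firstReturn x l₁ + l₁ : ℕ) := by rw [hm]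
    push_cast at this
    linarith
  obtain ⟨τ, hτ, hshort⟩ := exists_shift_of_overlapping_returns x (by omega : l₁ < n) hlow
    (hhigh ▸ hlow) hm
  have hτ' : (firstReturn x m : ℝ) + τ ≤ firstReturn x n := by exact_mod_cast hτ
  have hRm := hB m
  have hdiff : r * M - firstReturn x n - B ≤ M - τ := by
    rw [hmM] at hRm
    linarith
  have hrdiff : (firstReturn x n : ℝ) + B ≤ r * (M - τ) := by
    have := mul_le_mul_of_nonneg_left hdiff hr0.le
    linarith
  have hτm : τ ≤ m := by
    have h1 : 0 < M - τ := pos_of_mul_pos_right (hpos.trans_le hrdiff) hr0.le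
    have h2 : (τ : ℝ) ≤ m := by linarith
    exact_mod_cast h2
  have hfinal : (firstReturn x (m - τ) : ℝ) + m < firstReturn x n + τ := by
    exact_mod_cast hshort hτm
  have hlast := hB (m - τ)
  rw [Nat.cast_sub hτm, hmM] at hlast
  rw [hmM] at hfinal
  linarith

lemma natCast_le_complexity {A : Type*} [Fintype A] (x : ℕ → A)
    (hx : ¬ UltimatelyPeriodic x) (n : ℕ) : n ≤ complexity x n := by
  have := complexity_add_le x hx 0 n
  rw [zero_add] at this
  omega

theorem stmt8 {A : Type*} [Fintype A] (x : ℕ → A)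
    (hx : ¬ UltimatelyPeriodic x) (ρ : ℝ)
    (hrep : liminf (fun n : ℕ => (((minReturn x n : ℝ) / n : ℝ) : EReal)) atTop = (ρ : EReal)) :
    ((ρ - 1 + 1 / ρ ^ 3 : ℝ) : EReal) ≤
      liminf (fun n : ℕ => (((complexity x n : ℝ) / n : ℝ) : EReal)) atTop := by
  have hρ : 1 ≤ ρ := by
    rw [← EReal.coe_le_coe_iff, ← hrep]
    refine le_liminf_of_le (by isBoundedDefault) ?_
    filter_upwards [eventually_gt_atTop 0] with n hn
    rw [EReal.coe_le_coe_iff, one_le_div (by exact_mod_cast hn)]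
    exact_mod_cast le_minReturn x n
  have hρ0 : 0 < ρ := by linarith
  refine EReal.ge_of_forall_gt_iff_ge.1 fun z hz => ?_
  rw [EReal.coe_lt_coe_iff] at hz
  suffices h : ∀ᶠ n : ℕ in atTop, z * n ≤ complexity x n by
    refine le_liminf_of_le (by isBoundedDefault) ?_
    filter_upwards [h, eventually_gt_atTop 0] with n hn hn0
    rwa [EReal.coe_le_coe_iff, le_div_iff₀ (by exact_mod_cast hn0)]
  rcases le_or_gt (ρ ^ 3 - ρ ^ 2 - ρ - 1) 0 with htrib | htrib
  · have hone : ρ - 1 + 1 / ρ ^ 3 ≤ 1 := by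
      have h1 : 1 / ρ ^ 3 ≤ 2 - ρ := by
        rw [div_le_iff₀ (by positivity)]
        have := mul_nonneg (neg_nonneg.2 htrib) (sub_nonneg.2 hρ)
        linarith
      linarith
    refine Eventually.of_forall fun n => ?_
    have h1 : (n : ℝ) ≤ complexity x n := by exact_mod_cast natCast_le_complexity x hx n
    exact (mul_le_of_le_one_left n.cast_nonneg (by linarith)).trans h1
  · have hρ1 : 1 < ρ := by
      refine lt_of_le_of_ne hρ ?_
      rintro rfl
      norm_num at htrib
    set η := (ρ - 1 + 1 / ρ ^ 3 - z) / 2 with hη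
    have hηpos : 0 < η := by linarith
    obtain ⟨r, ⟨⟨hr1, hr3⟩, hrη⟩, hrρ⟩ : ∃ r : ℝ,
        ((1 < r ∧ 0 < r ^ 3 - r ^ 2 - r - 1) ∧ ρ - η < r) ∧ r < ρ := by
      have hcont : ContinuousAt (fun r : ℝ => r ^ 3 - r ^ 2 - r - 1) ρ := by fun_prop
      have hev := (((eventually_gt_nhds hρ1).and (hcont.eventually_const_lt htrib)).and
        (eventually_gt_nhds (by linarith : ρ - η < ρ))).filter_mono
          (nhdsWithin_le_nhds (s := Set.Iio ρ))
      exact (hev.and self_mem_nhdsWithin).exists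
    have hlt : ((r : ℝ) : EReal) <
        liminf (fun n : ℕ => (((minReturn x n : ℝ) / n : ℝ) : EReal)) atTop := by
      rw [hrep]
      exact_mod_cast hrρ
    obtain ⟨K, hK⟩ := eventually_atTop.1 (eventually_lt_of_lt_liminf hlt)
    have hB : ∀ k : ℕ, (r - 1) * k - (r - 1) * K ≤ firstReturn x k := by
      intro k
      rcases le_or_gt k K with hk | hk
      · have h1 : (k : ℝ) ≤ K := by exact_mod_cast hk
        have h2 := mul_le_mul_of_nonneg_left h1 (sub_pos.2 hr1).le
        have h3 : (0 : ℝ) ≤ firstReturn x k := Nat.cast_nonneg _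
        linarith
      · have h1 := hK k hk.le
        have hk0 : (0 : ℝ) < k := by exact_mod_cast (by omega : 0 < k)
        rw [EReal.coe_lt_coe_iff, lt_div_iff₀ hk0] at h1
        have h2 : (minReturn x k : ℝ) ≤ firstReturn x k + k := by
          exact_mod_cast minReturn_le_firstReturn_add x k
        have h3 : 0 ≤ (r - 1) * K := mul_nonneg (sub_pos.2 hr1).le (Nat.cast_nonneg _)
        linarith
    filter_upwards [eventually_mul_le_complexity x hx hr1 hr3.le hηpos hB] with n hn
    refine le_trans (mul_le_mul_of_nonneg_right ?_ n.cast_nonneg) hn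
    have : 1 / ρ ^ 3 ≤ 1 / r ^ 3 := by gcongr
    linarith
end

section
/- Let b ≥ 2 be an integer and ξ an irrational real number with irrationality exponent μ. Then limsup_{n→∞} r(n, ξ, b)/n ≥ 2 + (1 − 2μ(μ−1)(μ−2)) / (3μ³ − 6μ² + 4μ − 1), where r(n, ξ, b) is the smallest m such that some block of length n occurs twice in the first m digits of the base-b expansion of ξ. -/
open Filter

/-- The `k`-th digit (0-indexed; this is `a_{k+1}`) of the base-`b` expansion
of `ξ`, i.e. `a_j = ⌊b^j ξ⌋ mod b`. -/
noncomputable def digit (b : ℕ) (ξ : ℝ) (k : ℕ) : ℕ :=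
  (⌊ξ * (b : ℝ) ^ (k + 1)⌋ % (b : ℤ)).toNat

/-- The irrationality exponent of `ξ`, as an extended real: the supremum of
all real `μ` such that `|ξ - p/q| < q^(-μ)` has infinitely many rational
solutions `p/q` with `q ≥ 1`. -/
noncomputable def irrationalityExponent (ξ : ℝ) : EReal :=
  sSup {e : EReal | ∃ μ : ℝ, e = (μ : EReal) ∧
    {pq : ℤ × ℕ | 1 ≤ pq.2 ∧ |ξ - pq.1 / pq.2| < (pq.2 : ℝ) ^ (-μ)}.Infinite}

/-- The words of length `L` starting at positions `i` and `j` coincide. -/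
def Agree {A : Type*} (x : ℕ → A) (i j L : ℕ) : Prop :=
  ∀ t < L, x (i + t) = x (j + t)

theorem floor_mul_eq_digit {b : ℕ} (hb : 2 ≤ b) (ξ : ℝ) (k : ℕ) :
    ⌊ξ * (b : ℝ) ^ (k + 1)⌋ = b * ⌊ξ * (b : ℝ) ^ k⌋ + (digit b ξ k : ℤ) := by
  have hb0 : (0 : ℝ) < b := by positivity
  have h1 : ⌊ξ * (b : ℝ) ^ (k + 1)⌋ / (b : ℤ) = ⌊ξ * (b : ℝ) ^ k⌋ := by
    rw [← Int.floor_div_natCast]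
    congr 1
    rw [pow_succ]
    field_simp
  have h2 : (digit b ξ k : ℤ) = ⌊ξ * (b : ℝ) ^ (k + 1)⌋ % (b : ℤ) := by
    unfold digit
    exact Int.toNat_of_nonneg (Int.emod_nonneg _ (by omega))
  rw [h2, ← h1]
  exact (Int.mul_ediv_add_emod _ _).symm

theorem digit_lt {b : ℕ} (hb : 2 ≤ b) (ξ : ℝ) (k : ℕ) : digit b ξ k < b := by
  unfold digit
  have h1 := Int.emod_nonneg ⌊ξ * (b : ℝ) ^ (k + 1)⌋ (b := (b : ℤ)) (by omega)
  have h2 := Int.emod_lt_of_pos ⌊ξ * (b : ℝ) ^ (k + 1)⌋ (b := (b : ℤ)) (by omega)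
  omega

theorem Agree.floor_sub {b : ℕ} (hb : 2 ≤ b) {ξ : ℝ} {i j L : ℕ}
    (h : Agree (digit b ξ) i j L) :
    ⌊ξ * (b : ℝ) ^ (i + L)⌋ - b ^ L * ⌊ξ * (b : ℝ) ^ i⌋ =
      ⌊ξ * (b : ℝ) ^ (j + L)⌋ - b ^ L * ⌊ξ * (b : ℝ) ^ j⌋ := by
  induction L with
  | zero => simp
  | succ L ih =>
    have h1 := ih fun t ht => h t (by omega)
    have h2 := h L (by omega)
    have h3 := floor_mul_eq_digit hb ξ (i + L)
    have h4 := floor_mul_eq_digit hb ξ (j + L)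
    rw [← add_assoc, ← add_assoc, h3, h4, h2, pow_succ]
    linear_combination (b : ℤ) * h1

theorem Agree.abs_sub_lt {b : ℕ} (hb : 2 ≤ b) {ξ : ℝ} {i j L : ℕ}
    (h : Agree (digit b ξ) i j L) :
    |((b : ℝ) ^ j - (b : ℝ) ^ i) * ξ - ((⌊ξ * (b : ℝ) ^ j⌋ - ⌊ξ * (b : ℝ) ^ i⌋ : ℤ) : ℝ)|
      * (b : ℝ) ^ L < 1 := by
  have h1 := h.floor_sub hb
  have h2 : (⌊ξ * (b : ℝ) ^ (i + L)⌋ : ℝ) - b ^ L * ⌊ξ * (b : ℝ) ^ i⌋ =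
      ⌊ξ * (b : ℝ) ^ (j + L)⌋ - b ^ L * ⌊ξ * (b : ℝ) ^ j⌋ := by exact_mod_cast h1
  have hbL : (0 : ℝ) ≤ (b : ℝ) ^ L := by positivity
  have e : (((b : ℝ) ^ j - (b : ℝ) ^ i) * ξ
      - ((⌊ξ * (b : ℝ) ^ j⌋ - ⌊ξ * (b : ℝ) ^ i⌋ : ℤ) : ℝ)) * (b : ℝ) ^ L =
      Int.fract (ξ * (b : ℝ) ^ (j + L)) - Int.fract (ξ * (b : ℝ) ^ (i + L)) := by
    push_cast
    rw [Int.fract, Int.fract]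
    linear_combination -h2
  rw [← abs_of_nonneg hbL, ← abs_mul, e]
  have := Int.fract_nonneg (ξ * (b : ℝ) ^ (j + L))
  have := Int.fract_nonneg (ξ * (b : ℝ) ^ (i + L))
  have := Int.fract_lt_one (ξ * (b : ℝ) ^ (j + L))
  have := Int.fract_lt_one (ξ * (b : ℝ) ^ (i + L))
  rw [abs_lt]
  constructor <;> linarith

theorem finite_of_irrationalityExponent_lt {ξ μ μ' : ℝ}
    (hμ : irrationalityExponent ξ = (μ : EReal)) (h : μ < μ') :
    {pq : ℤ × ℕ | 1 ≤ pq.2 ∧ |ξ - pq.1 / pq.2| < (pq.2 : ℝ) ^ (-μ')}.Finite := by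
  by_contra hinf
  have h1 : (μ' : EReal) ≤ irrationalityExponent ξ := le_sSup ⟨μ', rfl, hinf⟩
  rw [hμ, EReal.coe_le_coe_iff] at h1
  linarith

theorem two_le_of_irrationalityExponent_eq {ξ μ : ℝ} (hξ : Irrational ξ)
    (hμ : irrationalityExponent ξ = (μ : EReal)) : 2 ≤ μ := by
  have h1 : ((2 : ℝ) : EReal) ≤ irrationalityExponent ξ := by
    refine le_sSup ⟨2, rfl, ?_⟩
    have h := Real.infinite_rat_abs_sub_lt_one_div_den_sq_of_irrational hξ
    refine (h.image (f := fun q : ℚ => (q.num, q.den)) ?_).mono ?_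
    · intro p _ q _ hpq
      simp only [Prod.mk.injEq] at hpq
      exact Rat.ext hpq.1 hpq.2
    · rintro _ ⟨q, hq, rfl⟩
      refine ⟨q.den_pos, ?_⟩
      have e : (q : ℝ) = (q.num : ℝ) / (q.den : ℝ) := Rat.cast_def q
      have hq' : |ξ - q| < 1 / (q.den : ℝ) ^ 2 := hq
      have e2 : (q.den : ℝ) ^ (-2 : ℝ) = 1 / (q.den : ℝ) ^ 2 := by
        rw [Real.rpow_neg (by positivity), one_div]
        norm_cast
      simp only
      rw [← e, e2]
      exact hq'
  rw [hμ, EReal.coe_le_coe_iff] at h1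
  exact h1

/-- Repetitions in the expansion of `ξ` are limited by its irrationality exponent. -/
theorem exists_agree_length_le {b : ℕ} (hb : 2 ≤ b) {ξ μ μ' : ℝ} (hξ : Irrational ξ)
    (hμ : irrationalityExponent ξ = (μ : EReal)) (h : μ < μ') :
    ∃ C : ℝ, 0 ≤ C ∧ ∀ i j L : ℕ, i < j → Agree (digit b ξ) i j L →
      (L : ℝ) ≤ (μ' - 1) * j + C := by
  have hfin := finite_of_irrationalityExponent_lt hμ h
  have hμ2 := two_le_of_irrationalityExponent_eq hξ hμ
  have hb1 : (1 : ℝ) < b := by exact_mod_cast (by omega : 1 < b)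
  set S := {pq : ℤ × ℕ | 1 ≤ pq.2 ∧ |ξ - pq.1 / pq.2| < (pq.2 : ℝ) ^ (-μ')} with hS
  have hg : ∀ pq : ℤ × ℕ, ∃ N : ℕ, 1 ≤ pq.2 → 1 < |(pq.2 : ℝ) * ξ - pq.1| * (b : ℝ) ^ N := by
    intro pq
    by_cases hq : 1 ≤ pq.2
    · have hpos : 0 < |(pq.2 : ℝ) * ξ - pq.1| := by
        rw [abs_pos]
        exact ((hξ.natCast_mul (by omega)).sub_intCast pq.1).ne_zero
      obtain ⟨N, hN⟩ := pow_unbounded_of_one_lt (1 / |(pq.2 : ℝ) * ξ - pq.1|) hb1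
      refine ⟨N, fun _ => ?_⟩
      rw [div_lt_iff₀ hpos] at hN
      linarith
    · exact ⟨0, fun h => absurd h hq⟩
  choose g hg using hg
  obtain ⟨C, hC⟩ := (hfin.image g).bddAbove
  refine ⟨C, Nat.cast_nonneg C, ?_⟩
  intro i j L hij hag
  have hlt := hag.abs_sub_lt hb
  have hbij : b ^ i < b ^ j := Nat.pow_lt_pow_right (by omega) hij
  set p : ℤ := ⌊ξ * (b : ℝ) ^ j⌋ - ⌊ξ * (b : ℝ) ^ i⌋
  have hQ : (((b ^ j - b ^ i : ℕ)) : ℝ) = (b : ℝ) ^ j - (b : ℝ) ^ i := by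
    rw [Nat.cast_sub hbij.le]; push_cast; rfl
  set Q : ℕ := b ^ j - b ^ i with hQdef
  have hQ1 : 1 ≤ Q := by omega
  have hQle : (Q : ℝ) ≤ (b : ℝ) ^ j := by
    rw [hQ]; have : (0 : ℝ) ≤ (b : ℝ) ^ i := by positivity
    linarith
  rw [← hQ] at hlt
  have hQ0 : (0 : ℝ) < Q := by exact_mod_cast hQ1
  have hν : 0 ≤ μ' - 1 := by linarith
  by_cases hmem : (p, Q) ∈ S
  · have h1 : g (p, Q) ≤ C := hC ⟨_, hmem, rfl⟩
    have h2 := hg (p, Q) hQ1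
    simp only at h2
    have h3 : L ≤ g (p, Q) := by
      by_contra hcon
      have h4 : (b : ℝ) ^ (g (p, Q)) ≤ (b : ℝ) ^ L := pow_le_pow_right₀ hb1.le (by omega)
      have := mul_le_mul_of_nonneg_left h4 (abs_nonneg ((Q : ℝ) * ξ - p))
      linarith
    have h5 : (L : ℝ) ≤ C := by exact_mod_cast h3.trans h1
    have : 0 ≤ (μ' - 1) * j := by positivity
    linarith
  · have h1 : (Q : ℝ) ^ (-μ') ≤ |ξ - p / Q| := by
      by_contra hcon
      exact hmem ⟨hQ1, by simpa using hcon⟩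
    have e : |(Q : ℝ) * ξ - p| = Q * |ξ - p / Q| := by
      rw [← abs_of_pos hQ0, ← abs_mul, abs_of_pos hQ0]
      congr 1
      field_simp
    have h2 : (Q : ℝ) ^ (1 - μ') ≤ |(Q : ℝ) * ξ - p| := by
      rw [e, sub_eq_add_neg, Real.rpow_add hQ0, Real.rpow_one]
      gcongr
    have h3 : (Q : ℝ) ^ (1 - μ') * (b : ℝ) ^ L < 1 :=
      lt_of_le_of_lt (by gcongr) hlt
    have h4 : (b : ℝ) ^ L < (Q : ℝ) ^ (μ' - 1) := by
      have e3 : (Q : ℝ) ^ (1 - μ') = ((Q : ℝ) ^ (μ' - 1))⁻¹ := by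
        rw [← Real.rpow_neg hQ0.le]; congr 1; ring
      rw [e3, inv_mul_eq_div, div_lt_one (by positivity)] at h3
      exact h3
    have h5 : (b : ℝ) ^ (L : ℝ) < (b : ℝ) ^ ((j : ℝ) * (μ' - 1)) := by
      rw [Real.rpow_natCast, Real.rpow_mul (by positivity), Real.rpow_natCast]
      exact h4.trans_le (Real.rpow_le_rpow hQ0.le hQle hν)
    have h6 := (Real.rpow_lt_rpow_left_iff hb1).1 h5
    have : (0 : ℝ) ≤ C := Nat.cast_nonneg C
    linarith

theorem returnSet_nonempty {x : ℕ → ℕ} {b : ℕ} (hx : ∀ k, x k < b) (n : ℕ) :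
    (returnSet x n).Nonempty := by
  obtain ⟨i, j, hij, h⟩ := Finite.exists_ne_map_eq_of_infinite
    (fun j : ℕ => fun k : Fin n => (⟨x (j + k), hx _⟩ : Fin b))
  have key : ∀ i j : ℕ, i < j → (∀ k < n, x (i + k) = x (j + k)) →
      (returnSet x n).Nonempty := by
    intro i j hij h
    refine ⟨j + n, i, by omega, fun k hk => ?_⟩
    rw [Nat.add_sub_cancel]
    exact h k hk
  have h' : ∀ k < n, x (i + k) = x (j + k) := by
    intro k hk
    simpa using congrArg Fin.val (congrFun h ⟨k, hk⟩)
  rcases lt_or_gt_of_ne hij with h1 | h1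
  · exact key i j h1 h'
  · exact key j i h1 fun k hk => (h' k hk).symm

theorem exists_agree_minReturn {x : ℕ → ℕ} {b : ℕ} (hx : ∀ k, x k < b) (n : ℕ) :
    ∃ i s : ℕ, i < s ∧ minReturn x n = s + n ∧ Agree x i s n := by
  obtain ⟨i, hi, h⟩ := Nat.sInf_mem (returnSet_nonempty hx n)
  change i + n < minReturn x n at hi
  exact ⟨i, minReturn x n - n, by omega, by omega, h⟩

theorem Agree.minReturn_le {x : ℕ → ℕ} {i s n : ℕ} (his : i < s) (h : Agree x i s n) :
    minReturn x n ≤ s + n := by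
  refine Nat.sInf_le ⟨i, by omega, fun k hk => ?_⟩
  rw [Nat.add_sub_cancel]
  exact h k hk

/-- A repetition that realizes `minReturn x n` can be lengthened until it is maximal. -/
theorem exists_maximal_agree {x : ℕ → ℕ} {b : ℕ} (hx : ∀ k, x k < b)
    (hbdd : ∀ s, ∃ N, ∀ i L, i < s → Agree x i s L → L ≤ N) (m : ℕ) :
    ∃ i s n : ℕ, i < s ∧ m ≤ n ∧ minReturn x m = s + m ∧ Agree x i s n ∧
      x (i + n) ≠ x (s + n) ∧ s + (n + 1) < minReturn x (n + 1) := by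
  obtain ⟨i₀, s, his₀, hs, hag₀⟩ := exists_agree_minReturn hx m
  obtain ⟨N, hN⟩ := hbdd s
  classical
  set P : ℕ → Prop := fun L => ∃ i, i < s ∧ Agree x i s L
  have hPm : P m := ⟨i₀, his₀, hag₀⟩
  have hmN : m ≤ N := hN i₀ m his₀ hag₀
  obtain ⟨i, his, hag⟩ : P (Nat.findGreatest P N) := Nat.findGreatest_spec hmN hPm
  have hle : m ≤ Nat.findGreatest P N := Nat.le_findGreatest hmN hPm
  set n := Nat.findGreatest P N
  have hmax : ¬ P (n + 1) := by
    rintro ⟨i', h1, h2⟩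
    have := Nat.le_findGreatest (P := P) (hN i' _ h1 h2) ⟨i', h1, h2⟩
    change n + 1 ≤ n at this
    omega
  refine ⟨i, s, n, his, hle, hs, hag, ?_, ?_⟩
  · intro heq
    refine hmax ⟨i, his, fun t ht => ?_⟩
    rcases Nat.lt_succ_iff_lt_or_eq.1 ht with h | rfl
    · exact hag t h
    · exact heq
  · obtain ⟨i', s', h1, h2, h3⟩ := exists_agree_minReturn hx (n + 1)
    have h3' : Agree x i' s' m := fun t ht => h3 t (by omega)
    have h4 : minReturn x m ≤ s' + m := h3'.minReturn_le h1
    have h5 : s' ≠ s := by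
      rintro rfl
      exact hmax ⟨i', h1, h3⟩
    omega

theorem exists_maximal_agree_seq {x : ℕ → ℕ} {b : ℕ} (hx : ∀ k, x k < b)
    (hbdd : ∀ s, ∃ N, ∀ i L, i < s → Agree x i s L → L ≤ N) (m : ℕ) :
    ∃ i s n : ℕ → ℕ, (∀ k, i k < s k) ∧ (∀ k, Agree x (i k) (s k) (n k)) ∧
      (∀ k, x (i k + n k) ≠ x (s k + n k)) ∧ StrictMono s ∧ StrictMono n ∧ (∀ k, m ≤ n k) ∧
      ∀ k, minReturn x (n k + 1) = s (k + 1) + (n k + 1) := by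
  choose I S N h1 h2 h3 h4 h5 h6 using exists_maximal_agree hx hbdd
  set M : ℕ → ℕ := fun k => Nat.rec m (fun _ p => N p + 1) k with hM
  have hM1 : ∀ k, M (k + 1) = N (M k) + 1 := fun k => rfl
  have hM2 : Monotone M := monotone_nat_of_le_succ fun k => by
    rw [hM1]; have := h2 (M k); omega
  refine ⟨fun k => I (M k), fun k => S (M k), fun k => N (M k), fun k => h1 _, fun k => h4 _,
    fun k => h5 _, strictMono_nat_of_lt_succ fun k => ?_, strictMono_nat_of_lt_succ fun k => ?_,
    fun k => ?_, fun k => h3 (N (M k) + 1)⟩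
  · have a := h6 (M k)
    have c := h3 (M (k + 1))
    simp only [hM1] at c ⊢
    omega
  · have := h2 (M (k + 1))
    simp only [hM1] at this ⊢
    omega
  · have a := h2 (M k)
    have c : M 0 ≤ M k := hM2 (Nat.zero_le k)
    change m ≤ M k at c
    simp only
    omega

/-- Two periodic runs, the shorter of which is maximal, cannot overlap too much. -/
theorem Agree.min_add_lt {x : ℕ → ℕ} {i s n i' s' n' : ℕ} (his : i < s) (his' : i' < s')
    (h : Agree x i s n) (hne : x (i + n) ≠ x (s + n)) (h' : Agree x i' s' n')
    (hlt : s + n < s' + n') : min i i' + n < s' := by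
  by_contra hcon
  push Not at hcon
  have hi : s' ≤ i + n := hcon.trans (by omega)
  have hi' : s' ≤ i' + n := hcon.trans (by omega)
  refine hne ?_
  have e1 : x (i + n) = x (i + n - (s' - i')) := by
    have := h' (i + n - s') (by omega)
    rw [show i + n - (s' - i') = i' + (i + n - s') by omega, this]
    congr 1; omega
  have e2 : x (s + n) = x (s + n - (s' - i')) := by
    have := h' (s + n - s') (by omega)
    rw [show s + n - (s' - i') = i' + (s + n - s') by omega, this]
    congr 1; omega
  have e3 : x (i + n - (s' - i')) = x (s + n - (s' - i')) := by
    have := h (n - (s' - i')) (by omega)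
    rw [show i + n - (s' - i') = i + (n - (s' - i')) by omega,
      show s + n - (s' - i') = s + (n - (s' - i')) by omega, this]
  rw [e1, e2, e3]

/-- Two periodic runs starting early produce a run whose period is the difference of theirs. -/
theorem Agree.le_or_le {x : ℕ → ℕ} {ν C : ℝ} (hν : 1 ≤ ν) (hC : 0 ≤ C)
    (hB : ∀ i j L : ℕ, i < j → Agree x i j L → (L : ℝ) ≤ ν * j + C)
    {i s n i' s' n' : ℕ} (his : i < s) (his' : i' < s') (h : Agree x i s n)
    (hne : x (i + n) ≠ x (s + n)) (h' : Agree x i' s' n') (hn : n < n') (hs : s < s')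
    (hi : i ≤ i') :
    (i : ℝ) + n ≤ (ν + 1) * (s' - s + i) + C ∨ (n : ℝ) ≤ (2 * ν + 1) * i' + C := by
  rcases lt_trichotomy (s' - i') (s - i) with hd | hd | hd
  · right
    obtain ⟨e, he⟩ : ∃ e, s - i = s' - i' + e := ⟨_, (Nat.add_sub_of_le hd.le).symm⟩
    have hag : Agree x i' (i' + e) (i + n - i') := by
      intro t ht
      have a := h (i' + t - i) (by omega)
      have c := h' (e + t) (by omega)
      rw [show i + (i' + t - i) = i' + t by omega] at a
      rw [show i' + (e + t) = i' + e + t by omega] at c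
      rw [a, c]
      congr 1; omega
    have h1 := hB _ _ _ (by omega) hag
    have h2 : (i : ℝ) + n ≤ ((i + n - i' : ℕ) : ℝ) + i' := by
      exact_mod_cast (by omega : i + n ≤ (i + n - i') + i')
    have h3 : ((i' + e : ℕ) : ℝ) ≤ 2 * i' := by
      exact_mod_cast (by omega : i' + e ≤ 2 * i')
    have h4 : ν * ((i' + e : ℕ) : ℝ) ≤ ν * (2 * i') := by gcongr
    have : (0 : ℝ) ≤ i := Nat.cast_nonneg i
    linarith
  · right
    have h1 : n ≤ i' := by
      by_contra hcon
      refine hne ?_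
      have c := h' (i + n - i') (by omega)
      rw [show i' + (i + n - i') = i + n by omega] at c
      rw [c]
      congr 1; omega
    have h2 : (n : ℝ) ≤ i' := by exact_mod_cast h1
    have : 0 ≤ ν * i' := by positivity
    linarith
  · left
    obtain ⟨e, he⟩ : ∃ e, s' - i' = s - i + e := ⟨_, (Nat.add_sub_of_le hd.le).symm⟩
    have hag : Agree x i' (i' + e) (i + n - (i' + e)) := by
      intro t ht
      have a := h (i' + e + t - i) (by omega)
      have c := h' t (by omega)
      rw [show i + (i' + e + t - i) = i' + e + t by omega] at a
      rw [a, c]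
      congr 1; omega
    have h1 := hB _ _ _ (by omega) hag
    have h2 : (i : ℝ) + n ≤ ((i + n - (i' + e) : ℕ) : ℝ) + ((i' + e : ℕ) : ℝ) := by
      exact_mod_cast (by omega : i + n ≤ (i + n - (i' + e)) + (i' + e))
    have h3 : ((i' + e : ℕ) : ℝ) = s' - s + i := by
      have : i' + e + s = s' + i := by omega
      have h : ((i' + e : ℕ) : ℝ) + s = s' + i := by exact_mod_cast this
      linarith
    rw [h3] at h1 h2
    linarith

theorem polynomial_bounds {μ δ : ℝ} (hμ : 2 ≤ μ) (hδ : 0 < δ)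
    (h : δ * (3 * μ ^ 3 - 6 * μ ^ 2 + 4 * μ - 1) = 1 - 2 * μ * (μ - 1) * (μ - 2)) :
    μ * ((μ - 1) ^ 2 * (1 + δ) ^ 2 - 1) + (μ - 1) ^ 2 * δ < μ - 1 ∧
      (2 * μ - 1) * (δ * ((μ - 1) ^ 2 * (1 + δ) ^ 2)) < 1 := by
  obtain ⟨t, rfl⟩ : ∃ t, μ = 2 + t := ⟨μ - 2, by ring⟩
  have ht : 0 ≤ t := by linarith
  have hD : δ * (7 + 16 * t + 12 * t ^ 2 + 3 * t ^ 3) = 1 - 2 * t * (1 + t) * (2 + t) := by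
    linear_combination h
  have hδ7 : δ ≤ 1 / 7 := by
    have h1 : 0 ≤ δ * (16 * t + 12 * t ^ 2 + 3 * t ^ 3) := by positivity
    have h2 : 0 ≤ 2 * t * (1 + t) * (2 + t) := by positivity
    linarith
  have hpos : 2 * t * (1 + t) * (2 + t) < 1 := by
    have : 0 < δ * (7 + 16 * t + 12 * t ^ 2 + 3 * t ^ 3) := by positivity
    linarith
  have ht1 : t < 21 / 100 := by
    by_contra hcon
    push Not at hcon
    have : 2 * (21 / 100) * (1 + 21 / 100) * (2 + 21 / 100) ≤ 2 * t * (1 + t) * (2 + t) := by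
      gcongr
    norm_num at this
    linarith
  have hsq : (1 + δ) ^ 2 ≤ 1 + 15 / 7 * δ := by nlinarith
  constructor
  · have h1 : (2 + t) * ((1 + t) ^ 2 * (1 + δ) ^ 2) ≤
        (2 + t) * ((1 + t) ^ 2 * (1 + 15 / 7 * δ)) := by gcongr
    have h2 : 0 ≤ t ^ 2 := by positivity
    have h3 : 0 ≤ t ^ 3 := by positivity
    have h4 : 0 < δ * ((7 + 16 * t + 12 * t ^ 2 + 3 * t ^ 3) * (1 + t)
        - (15 / 7 * (2 + t) * (1 + t) ^ 2 + (1 + t) ^ 2)) := by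
      apply mul_pos hδ
      have e : (7 + 16 * t + 12 * t ^ 2 + 3 * t ^ 3) * (1 + t)
        - (15 / 7 * (2 + t) * (1 + t) ^ 2 + (1 + t) ^ 2) =
        12 / 7 + 72 / 7 * t + 129 / 7 * t ^ 2 + 90 / 7 * t ^ 3 + 3 * t ^ 4 := by ring
      rw [e]; positivity
    have h5 : 0 ≤ t * (1 + t) * (2 + t) * (t * (3 + 2 * t)) := by positivity
    have h6 : δ * (7 + 16 * t + 12 * t ^ 2 + 3 * t ^ 3) * (1 + t) =
      (1 - 2 * t * (1 + t) * (2 + t)) * (1 + t) := by rw [hD]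
    have h7 : 0 ≤ t ^ 4 := by positivity
    nlinarith
  · have h1 : (2 * (2 + t) - 1) * (δ * ((2 + t - 1) ^ 2 * (1 + δ) ^ 2)) ≤
        (2 * (2 + 21 / 100) - 1) * (1 / 7 * ((2 + 21 / 100 - 1) ^ 2 * (1 + 1 / 7) ^ 2)) := by
      have : 0 ≤ 2 + t - 1 := by linarith
      have : 0 ≤ 2 * (2 + t) - 1 := by linarith
      gcongr
    norm_num at h1 ⊢
    linarith

theorem exists_gt_polynomial_bounds {μ δ : ℝ}
    (h : μ * ((μ - 1) ^ 2 * (1 + δ) ^ 2 - 1) + (μ - 1) ^ 2 * δ < μ - 1 ∧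
      (2 * μ - 1) * (δ * ((μ - 1) ^ 2 * (1 + δ) ^ 2)) < 1) :
    ∃ μ', μ < μ' ∧ μ' * ((μ' - 1) ^ 2 * (1 + δ) ^ 2 - 1) + (μ' - 1) ^ 2 * δ < μ' - 1 ∧
      (2 * μ' - 1) * (δ * ((μ' - 1) ^ 2 * (1 + δ) ^ 2)) < 1 := by
  have h1 : ∀ᶠ y in nhds μ, y * ((y - 1) ^ 2 * (1 + δ) ^ 2 - 1) + (y - 1) ^ 2 * δ < y - 1 :=
    ContinuousAt.eventually_lt (by fun_prop) (by fun_prop) h.1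
  have h2 : ∀ᶠ y in nhds μ, (2 * y - 1) * (δ * ((y - 1) ^ 2 * (1 + δ) ^ 2)) < 1 :=
    ContinuousAt.eventually_lt (by fun_prop) (by fun_prop) h.2
  have h3 : ∀ᶠ y in nhdsWithin μ (Set.Ioi μ), μ < y := eventually_mem_nhdsWithin
  obtain ⟨y, hy, hy'⟩ :=
    (h3.and ((h1.and h2).filter_mono nhdsWithin_le_nhds)).exists
  exact ⟨y, hy, hy'⟩

/-- Among the indices in a set meeting every pair of
consecutive integers, there are two, at distance at most two, along which `i` does not decrease. -/
theorem exists_le_of_mem_or_succ_mem (i : ℕ → ℕ) (T : Set ℕ) (hT : ∀ k, k ∈ T ∨ k + 1 ∈ T) :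
    ∃ k l, k ∈ T ∧ l ∈ T ∧ i k ≤ i l ∧ (l = k + 1 ∨ l = k + 2) := by
  have hne : T.Nonempty := (hT 0).elim (fun h => ⟨_, h⟩) fun h => ⟨_, h⟩
  obtain ⟨k, hk, hmin⟩ := exists_minimalFor_of_wellFoundedLT (· ∈ T) i hne
  have hmin' : ∀ l ∈ T, i k ≤ i l := fun l hl => (le_total (i k) (i l)).elim id (hmin hl)
  rcases hT (k + 1) with h | h
  · exact ⟨k, k + 1, hk, h, hmin' _ h, Or.inl rfl⟩
  · exact ⟨k, k + 2, hk, h, hmin' _ h, Or.inr rfl⟩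

/-- The shortest prefixes with a repetition cannot all be too short, if repetitions are limited. -/
theorem not_forall_minReturn_lt {x : ℕ → ℕ} {b : ℕ} (hx : ∀ k, x k < b) {ν δ C : ℝ}
    (hν : 1 ≤ ν) (hC : 0 ≤ C)
    (hB : ∀ i j L : ℕ, i < j → Agree x i j L → (L : ℝ) ≤ ν * j + C)
    (hδ : 0 < δ → (ν + 1) * (ν ^ 2 * (1 + δ) ^ 2 - 1) + ν ^ 2 * δ < ν ∧
      (2 * ν + 1) * (δ * (ν ^ 2 * (1 + δ) ^ 2)) < 1) (m : ℕ) :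
    ¬ ∀ n ≥ m, 1 ≤ n → (minReturn x n : ℝ) < (2 + δ) * n := by
  intro hr
  have hbdd : ∀ s, ∃ N, ∀ i L, i < s → Agree x i s L → L ≤ N := fun s =>
    ⟨⌊ν * s + C⌋₊, fun i L hi h => Nat.le_floor (hB i s L hi h)⟩
  set α := (ν + 1) * (ν ^ 2 * (1 + δ) ^ 2 - 1) + ν ^ 2 * δ with hα
  set β := (2 * ν + 1) * (δ * (ν ^ 2 * (1 + δ) ^ 2)) with hβ
  set A := ν + (ν + 1) * ν * (1 + δ) * (C + 1) + (ν + 1) * (1 + C) + ν * C with hA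
  set B := 1 + C + (2 * ν + 1) * (δ * (ν * (1 + δ) + 1) * (C + 1)) with hB'
  obtain ⟨m', hm'⟩ := exists_nat_gt (max (A / (ν - α)) (B / (1 - β)))
  obtain ⟨i, s, n, his, hag, hne, hs, hn, hmn, hret⟩ :=
    exists_maximal_agree_seq hx hbdd (max m m')
  have hs1 : ∀ k, (s (k + 1) : ℝ) < (1 + δ) * (n k + 1) := by
    intro k
    have h1 := hr (n k + 1) (by have := hmn k; omega) (by omega)
    rw [hret k] at h1
    push_cast at h1
    linarith
  have hmin : ∀ k, min (i k) (i (k + 1)) + n k < s (k + 1) := fun k =>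
    (hag k).min_add_lt (his k) (his (k + 1)) (hne k) (hag (k + 1))
      (by have := hs (Nat.lt_add_one k); have := hn (Nat.lt_add_one k); omega)
  have hδ0 : 0 < δ := by
    by_contra hcon
    push Not at hcon
    have h1 := hs1 0
    have h2 : ((n 0 : ℝ) + 1) ≤ s (0 + 1) := by
      exact_mod_cast (by have := hmin 0; omega : n 0 + 1 ≤ s (0 + 1))
    nlinarith
  obtain ⟨hα1, hβ1⟩ := hδ hδ0
  have hn1 : ∀ k, (n k : ℝ) ≤ ν * s k + C := fun k => hB _ _ _ (his k) (hag k)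
  obtain ⟨k, l, hk, hl, hil, hkl⟩ := exists_le_of_mem_or_succ_mem i
    {k | (i k : ℝ) ≤ δ * (n k + 1)} (by
      intro k
      have h1 := hs1 k
      have h2 : ((min (i k) (i (k + 1)) : ℕ) : ℝ) + n k + 1 ≤ s (k + 1) := by
        exact_mod_cast hmin k
      have h3 : ((min (i k) (i (k + 1)) : ℕ) : ℝ) ≤ δ * (n k + 1) := by linarith
      rcases le_total (i k) (i (k + 1)) with h | h
      · left
        rwa [min_eq_left h] at h3
      · right
        rw [min_eq_right h] at h3
        have h4 : (n k : ℝ) ≤ n (k + 1) := by exact_mod_cast (hn (Nat.lt_add_one k)).le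
        exact h3.trans (by gcongr))
  simp only [Set.mem_ofPred_eq] at hk hl
  have hkl' : k < l := by omega
  set y : ℝ := n k + 1 with hy
  have hsl : (s l : ℝ) ≤ (1 + δ) ^ 2 * ν * y + (1 + δ) * (C + 1) := by
    have h1 : (s (k + 1) : ℝ) ≤ (1 + δ) * y := (hs1 k).le
    have h2 := (hs1 (k + 1)).le
    have h3 := hn1 (k + 1)
    have h4 : ν * (s (k + 1) : ℝ) ≤ ν * ((1 + δ) * y) := by gcongr
    have h5 : (1 + δ) * ((n (k + 1) : ℝ) + 1) ≤ (1 + δ) * (ν * ((1 + δ) * y) + C + 1) := by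
      gcongr; linarith
    have h6 : (s l : ℝ) ≤ s (k + 2) := by
      exact_mod_cast hs.monotone (by omega : l ≤ k + 2)
    change (s (k + 2) : ℝ) ≤ _ at h2
    linarith
  have hmy : (max (A / (ν - α)) (B / (1 - β))) < y := by
    have : (m' : ℝ) ≤ n k := by exact_mod_cast (le_max_right m m').trans (hmn k)
    linarith
  have hyA : A < (ν - α) * y := by
    have := (le_max_left _ _).trans_lt hmy
    rwa [div_lt_iff₀' (by linarith)] at this
  have hyB : B < (1 - β) * y := by
    have := (le_max_right _ _).trans_lt hmy
    rwa [div_lt_iff₀' (by linarith)] at this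
  rcases (hag k).le_or_le hν hC hB (his k) (his l) (hne k) (hag l) (hn hkl') (hs hkl') hil
    with h | h
  · have h1 := hn1 k
    have h2 : ν * ((i k : ℝ) + n k) ≤ ν * ((ν + 1) * (s l - s k + i k) + C) := by gcongr
    have h3 : (ν + 1) * ν * (s l : ℝ) ≤
        (ν + 1) * ν * ((1 + δ) ^ 2 * ν * y + (1 + δ) * (C + 1)) := by gcongr
    have h4 : (ν + 1) * (n k : ℝ) ≤ (ν + 1) * (ν * s k + C) := by gcongr
    have h5 : ν ^ 2 * (i k : ℝ) ≤ ν ^ 2 * (δ * y) := by gcongr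
    have h6 : (n k : ℝ) = y - 1 := by rw [hy]; ring
    rw [h6] at h2 h4
    rw [hα, hA] at hyA
    linarith
  · have h1 := hn1 l
    have h2 : ν * (s l : ℝ) ≤ ν * ((1 + δ) ^ 2 * ν * y + (1 + δ) * (C + 1)) := by gcongr
    have h3 : δ * ((n l : ℝ) + 1) ≤
        δ * (ν * ((1 + δ) ^ 2 * ν * y + (1 + δ) * (C + 1)) + C + 1) := by
      gcongr; linarith
    have h4 : (2 * ν + 1) * (i l : ℝ) ≤ (2 * ν + 1) *
        (δ * (ν * ((1 + δ) ^ 2 * ν * y + (1 + δ) * (C + 1)) + C + 1)) := by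
      gcongr; linarith
    have h6 : (n k : ℝ) = y - 1 := by rw [hy]; ring
    rw [h6] at h
    rw [hβ, hB'] at hyB
    linarith

theorem stmt11 {b : ℕ} (hb : 2 ≤ b) (ξ : ℝ) (hξ : Irrational ξ) (μ : ℝ)
    (hμ : irrationalityExponent ξ = (μ : EReal)) :
    ((2 + (1 - 2 * μ * (μ - 1) * (μ - 2)) / (3 * μ ^ 3 - 6 * μ ^ 2 + 4 * μ - 1) : ℝ) : EReal) ≤
      limsup (fun n : ℕ => (((minReturn (digit b ξ) n : ℝ) / n : ℝ) : EReal)) atTop := by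
  by_contra hcon
  have hev := eventually_lt_of_limsup_lt (not_le.1 hcon)
  have hμ2 := two_le_of_irrationalityExponent_eq hξ hμ
  set δ := (1 - 2 * μ * (μ - 1) * (μ - 2)) / (3 * μ ^ 3 - 6 * μ ^ 2 + 4 * μ - 1) with hδ
  have hD : 0 < 3 * μ ^ 3 - 6 * μ ^ 2 + 4 * μ - 1 := by
    nlinarith [mul_nonneg (sq_nonneg μ) (sub_nonneg.2 hμ2)]
  obtain ⟨μ', hμ', hpoly⟩ : ∃ μ', μ < μ' ∧ (0 < δ →
      μ' * ((μ' - 1) ^ 2 * (1 + δ) ^ 2 - 1) + (μ' - 1) ^ 2 * δ < μ' - 1 ∧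
      (2 * μ' - 1) * (δ * ((μ' - 1) ^ 2 * (1 + δ) ^ 2)) < 1) := by
    by_cases h : 0 < δ
    · obtain ⟨μ', h1, h2⟩ := exists_gt_polynomial_bounds
        (polynomial_bounds hμ2 h (div_mul_cancel₀ _ hD.ne'))
      exact ⟨μ', h1, fun _ => h2⟩
    · exact ⟨μ + 1, by linarith, fun h' => absurd h' h⟩
  obtain ⟨C, hC, hB⟩ := exists_agree_length_le hb hξ hμ hμ'
  obtain ⟨m, hm⟩ := eventually_atTop.1 hev
  refine not_forall_minReturn_lt (digit_lt hb ξ) (ν := μ' - 1) (δ := δ) (by linarith) hC hB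
    (fun h => ?_) m fun n hn hn1 => ?_
  · obtain ⟨h1, h2⟩ := hpoly h
    constructor <;> linarith
  · have h1 := hm n hn
    rw [EReal.coe_lt_coe_iff, div_lt_iff₀ (by exact_mod_cast hn1)] at h1
    exact h1
end
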